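/- Let f be an orientation-preserving C^1 circle diffeomorphism with irrational rotation number α, with convergents p_n/q_n, and for x ∈ T let β_n(x) = |f^{q_n}(x) − x| be the length of the interval I_n(x) with endpoints x and f^{q_n}(x), m_n = min_{x∈T} β_n(x), M_n = max_{x∈T} β_n(x). If the sequence (M_n/m_n) is bounded, then f is C^1-conjugated to the rotation T_α: there exists a C^1 circle diffeomorphism h with h∘f = T_α∘h. -/

import Mathlib

open Filter Topology

/-- `ρ` is the rotation (translation) number of the lift `F`. -/
def IsRotNumber (F : ℝ → ℝ) (ρ : ℝ) : Prop :=
  ∀ x : ℝ, Tendsto (fun n : ℕ => (F^[n] x - x) / (n : ℝ)) atTop (𝓝 ρ)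

/-- Iterates of the Gauss map `G(x) = {1/x}`, starting from the fractional part of `α`:
`α₀ = {α}`, `α_{n+1} = {1/α_n}`. -/
noncomputable def gaussIter (α : ℝ) : ℕ → ℝ
  | 0 => Int.fract α
  | n + 1 => Int.fract (gaussIter α n)⁻¹

/-- The `(n+1)`-st partial quotient `a_{n+1} = ⌊1/α_n⌋` of the continued fraction of `α`. -/
noncomputable def cfa (α : ℝ) (n : ℕ) : ℕ := ⌊(gaussIter α n)⁻¹⌋₊

/-- The denominators `q_n` of the convergents of `α`: `q₀ = 1`, `q₁ = a₁`,
`q_{n+2} = a_{n+2} q_{n+1} + q_n`. -/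
noncomputable def qden (α : ℝ) : ℕ → ℕ
  | 0 => 1
  | 1 => cfa α 0
  | n + 2 => cfa α (n + 1) * qden α (n + 1) + qden α n

/-- The Brjuno condition: `Σ_n log(q_{n+1})/q_n < ∞`. -/
def IsBrjuno (α : ℝ) : Prop :=
  Summable fun n : ℕ => Real.log (qden α (n + 1)) / (qden α n : ℝ)

/-- The numerators `p_n` of the convergents of `α`: `p₀ = 0`, `p₁ = 1`,
`p_{n+2} = a_{n+2} p_{n+1} + p_n`. -/
noncomputable def pnum (α : ℝ) : ℕ → ℕ
  | 0 => 0
  | 1 => 1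
  | n + 2 => cfa α (n + 1) * pnum α (n + 1) + pnum α n

/-- `β_n(x) = |f^{q_n}(x) - x|`: the length of the circle interval `I_n(x)` with endpoints
`x` and `f^{q_n}(x)`, computed on the lift `F` as `|F^[q_n](x) - x - p_n|`. -/
noncomputable def betaN (α : ℝ) (F : ℝ → ℝ) (n : ℕ) (x : ℝ) : ℝ :=
  |F^[qden α n] x - x - (pnum α n : ℝ)|

/-- `M_n = max_{x ∈ 𝕋} β_n(x)`. -/
noncomputable def Mseq (α : ℝ) (F : ℝ → ℝ) (n : ℕ) : ℝ :=
  sSup (Set.range (betaN α F n))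

/-- `m_n = min_{x ∈ 𝕋} β_n(x)`. -/
noncomputable def mseq (α : ℝ) (F : ℝ → ℝ) (n : ℕ) : ℝ :=
  sInf (Set.range (betaN α F n))

section RotationNumber

variable {F : ℝ → ℝ} {α r K x : ℝ} {q : ℕ}

lemma IsRotNumber.tendsto_iterate_mul (hρ : IsRotNumber F α) (hq : 0 < q) (x : ℝ) :
    Tendsto (fun k : ℕ => (F^[k * q] x - x) / (k : ℝ)) atTop (𝓝 (q * α)) := by
  have h := ((hρ x).comp (tendsto_id.atTop_mul_const' hq)).const_mul (q : ℝ)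
  refine h.congr' ?_
  filter_upwards [eventually_gt_atTop 0] with k hk
  have : (k : ℝ) ≠ 0 := by positivity
  have : (q : ℝ) ≠ 0 := by positivity
  simp only [Function.comp_apply, id, Nat.cast_mul]
  field_simp

lemma IsRotNumber.mul_le (hρ : IsRotNumber F α) (hq : 0 < q)
    (h : ∀ k : ℕ, F^[k * q] x ≤ x + k * r + K) : q * α ≤ r := by
  have hr : Tendsto (fun k : ℕ => r + K / (k : ℝ)) atTop (𝓝 r) := by
    simpa using (tendsto_const_div_atTop_nhds_zero_nat K).const_add r
  refine le_of_tendsto_of_tendsto (hρ.tendsto_iterate_mul hq x) hr ?_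
  filter_upwards [eventually_gt_atTop 0] with k hk
  have hk' : (0 : ℝ) < k := by positivity
  rw [div_le_iff₀ hk', add_mul, div_mul_cancel₀ _ hk'.ne']
  linarith [h k]

lemma IsRotNumber.le_mul (hρ : IsRotNumber F α) (hq : 0 < q)
    (h : ∀ k : ℕ, x + k * r + K ≤ F^[k * q] x) : r ≤ q * α := by
  have hr : Tendsto (fun k : ℕ => r + K / (k : ℝ)) atTop (𝓝 r) := by
    simpa using (tendsto_const_div_atTop_nhds_zero_nat K).const_add r
  refine le_of_tendsto_of_tendsto hr (hρ.tendsto_iterate_mul hq x) ?_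
  filter_upwards [eventually_gt_atTop 0] with k hk
  have hk' : (0 : ℝ) < k := by positivity
  rw [le_div_iff₀ hk', add_mul, div_mul_cancel₀ _ hk'.ne']
  linarith [h k]

end RotationNumber

section ContinuedFraction

lemma gaussIter_irrational {α : ℝ} (hirr : Irrational α) (n : ℕ) :
    Irrational (gaussIter α n) := by
  induction n with
  | zero => exact hirr.sub_intCast _
  | succ n ih => exact ih.inv.sub_intCast _

lemma gaussIter_mem_Ioo {α : ℝ} (hirr : Irrational α) (n : ℕ) :
    gaussIter α n ∈ Set.Ioo (0 : ℝ) 1 := by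
  have h0 : 0 ≤ gaussIter α n := by cases n <;> exact Int.fract_nonneg _
  have h1 : gaussIter α n < 1 := by cases n <;> exact Int.fract_lt_one _
  exact ⟨h0.lt_of_ne (gaussIter_irrational hirr n).ne_zero.symm, h1⟩

lemma one_le_cfa {α : ℝ} (hirr : Irrational α) (n : ℕ) : 1 ≤ cfa α n := by
  have h := gaussIter_mem_Ioo hirr n
  exact Nat.le_floor (by simpa using (one_lt_inv₀ h.1).2 h.2 |>.le)

lemma cfa_mul_gaussIter {α : ℝ} (hirr : Irrational α) (n : ℕ) :
    cfa α n * gaussIter α n = 1 - gaussIter α (n + 1) * gaussIter α n := by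
  have h := gaussIter_mem_Ioo hirr n
  have h1 : (cfa α n : ℝ) = (gaussIter α n)⁻¹ - gaussIter α (n + 1) := by
    rw [gaussIter, Int.fract, cfa, natCast_floor_eq_intCast_floor (inv_nonneg.2 h.1.le)]
    ring
  rw [h1, sub_mul, inv_mul_cancel₀ h.1.ne']

lemma qden_pos {α : ℝ} (hirr : Irrational α) (n : ℕ) : 0 < qden α n := by
  induction n using Nat.twoStepInduction with
  | zero => exact Nat.one_pos
  | one => exact one_le_cfa hirr 0
  | more n ih _ => exact Nat.add_pos_right _ ih

lemma qden_mul_sub_pnum {α : ℝ} (hirr : Irrational α) (hα : α ∈ Set.Ioo (0 : ℝ) 1) (n : ℕ) :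
    qden α n * α - pnum α n = (-1) ^ n * ∏ i ∈ Finset.range (n + 1), gaussIter α i := by
  have h0 : gaussIter α 0 = α := Int.fract_eq_self.2 ⟨hα.1.le, hα.2⟩
  induction n using Nat.twoStepInduction with
  | zero => simp [qden, pnum, h0]
  | one =>
    have := cfa_mul_gaussIter hirr 0
    rw [h0] at this
    simp only [qden, pnum, Finset.prod_range_succ, Finset.prod_range_zero, h0]
    push_cast
    linarith
  | more n ih ih' =>
    have h := cfa_mul_gaussIter hirr (n + 1)
    simp only [qden, pnum]
    push_cast
    rw [Finset.prod_range_succ] at ih'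
    rw [Finset.prod_range_succ, Finset.prod_range_succ]
    rw [pow_succ] at ih' ⊢
    rw [pow_succ]
    linear_combination (cfa α (n + 1) : ℝ) * ih' + ih
      - (-1) ^ n * (∏ i ∈ Finset.range (n + 1), gaussIter α i) * h

lemma mul_gaussIter_succ_lt_half {α : ℝ} (hirr : Irrational α) (n : ℕ) :
    gaussIter α n * gaussIter α (n + 1) < 1 / 2 := by
  have h := cfa_mul_gaussIter hirr n
  have h0 := gaussIter_mem_Ioo hirr n
  have h1 := gaussIter_mem_Ioo hirr (n + 1)
  have hc : (1 : ℝ) ≤ cfa α n := by exact_mod_cast one_le_cfa hirr n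
  nlinarith [h0.1, h0.2, h1.1, h1.2]

lemma prod_gaussIter_le {α : ℝ} (hirr : Irrational α) (n : ℕ) :
    ∏ i ∈ Finset.range (2 * n + 1), gaussIter α i ≤ (1 / 2) ^ n := by
  induction n with
  | zero => simpa using (gaussIter_mem_Ioo hirr 0).2.le
  | succ n ih =>
    rw [show 2 * (n + 1) + 1 = 2 * n + 1 + 1 + 1 by ring, Finset.prod_range_succ,
      Finset.prod_range_succ, mul_assoc, pow_succ]
    have h1 := (gaussIter_mem_Ioo hirr (2 * n + 1)).1
    have h2 := (gaussIter_mem_Ioo hirr (2 * n + 1 + 1)).1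
    exact mul_le_mul ih (mul_gaussIter_succ_lt_half hirr _).le (by positivity) (by positivity)

lemma exists_qden_mul_sub_pnum_lt {α : ℝ} (hirr : Irrational α) (hα : α ∈ Set.Ioo (0 : ℝ) 1)
    {ε : ℝ} (hε : 0 < ε) :
    ∃ n, 0 < qden α n * α - pnum α n ∧ qden α n * α - pnum α n < ε := by
  obtain ⟨n, hn⟩ := exists_pow_lt_of_lt_one hε (by norm_num : (1 / 2 : ℝ) < 1)
  refine ⟨2 * n, ?_⟩
  rw [qden_mul_sub_pnum hirr hα, pow_mul]
  simp only [even_two, Even.neg_pow, one_pow, one_mul]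
  exact ⟨Finset.prod_pos fun i _ => (gaussIter_mem_Ioo hirr i).1,
    (prod_gaussIter_le hirr n).trans_lt hn⟩

end ContinuedFraction

section Lift

variable {F : ℝ → ℝ}

lemma iterate_add_natCast (hFper : ∀ x, F (x + 1) = F x + 1) (n m : ℕ) (x : ℝ) :
    F^[n] (x + m) = F^[n] x + m := by
  have h1 : ∀ y, F^[n] (y + 1) = F^[n] y + 1 := 
    (show Function.Commute F (· + 1) from hFper).iterate_left n
  induction m generalizing x with
  | zero => simp
  | succ m ih => rw [Nat.cast_succ, ← add_assoc, h1, ih, add_assoc]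

lemma iterate_sub_natCast (hFper : ∀ x, F (x + 1) = F x + 1) (n m : ℕ) (x : ℝ) :
    F^[n] (x - m) = F^[n] x - m := by
  rw [eq_sub_iff_add_eq, ← iterate_add_natCast hFper, sub_add_cancel]

/-- The lift `x ↦ F^[q] x - p` has small positive displacement, of oscillation controlled by `C`,
for suitable `q` and `p`. -/
def HasSmallReturns (F : ℝ → ℝ) (C : ℝ) : Prop :=
  ∀ ε > 0, ∃ q p : ℕ, (∀ x, 0 < F^[q] x - x - p ∧ F^[q] x - x - p < ε) ∧
    ∀ x y, F^[q] x - x - p ≤ C * (F^[q] y - y - p)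

lemma hasSmallReturns_of_bounded {α : ℝ} (hirr : Irrational α)
    (hα : α ∈ Set.Ioo (0 : ℝ) 1) (hF : Continuous F) (hmono : Monotone F)
    (hFper : ∀ x, F (x + 1) = F x + 1) (hρ : IsRotNumber F α)
    {C : ℝ} (hC : 1 ≤ C) (hbounded : ∀ n : ℕ, Mseq α F n ≤ C * mseq α F n) :
    HasSmallReturns F C := by
  intro ε hε
  obtain ⟨n, hpos, hlt⟩ := exists_qden_mul_sub_pnum_lt hirr hα (ε := ε / C) (by positivity)
  have hq := qden_pos hirr n
  have hM : ∀ x, betaN α F n x ≤ Mseq α F n := by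
    have hper : Function.Periodic (betaN α F n) 1 := fun x => by
      have := iterate_add_natCast hFper (qden α n) 1 x
      rw [Nat.cast_one] at this
      simp only [betaN, this]
      ring_nf
    have hcont : Continuous (betaN α F n) :=
      (((hF.iterate _).sub continuous_id).sub continuous_const).abs
    exact fun x => le_csSup (hper.isBounded_of_continuous one_ne_zero hcont).bddAbove ⟨x, rfl⟩
  have hm : ∀ x, mseq α F n ≤ betaN α F n x := fun x =>
    csInf_le ⟨0, by rintro _ ⟨y, rfl⟩; exact abs_nonneg _⟩ ⟨x, rfl⟩
  simp only [betaN] at hM hm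
  set q := qden α n
  set p := pnum α n
  have hpos' : ∀ x, 0 < F^[q] x - x - p := by
    intro x
    by_contra! hx
    have : q * α ≤ p := hρ.mul_le (x := x) (K := 0) hq fun k => by
      induction k with
      | zero => simp
      | succ k ih =>
        rw [Nat.succ_mul, add_comm, Function.iterate_add_apply]
        have h1 := (hmono.iterate q) ih
        rw [add_zero, ← Nat.cast_mul, iterate_add_natCast hFper] at h1
        push_cast at h1 ⊢
        linarith
    linarith
  have hm' : mseq α F n ≤ q * α - p := by
    have : p + mseq α F n ≤ q * α := hρ.le_mul (x := 0) (K := 0) hq fun k => by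
      induction k with
      | zero => simp
      | succ k ih =>
        rw [Nat.succ_mul, add_comm (k * q), Function.iterate_add_apply]
        have h1 := hm (F^[k * q] 0)
        rw [abs_of_pos (hpos' _)] at h1
        push_cast
        linarith
    linarith
  have habs : ∀ x, |F^[q] x - x - p| = F^[q] x - x - p := fun x => abs_of_pos (hpos' x)
  simp only [habs] at hM hm
  refine ⟨q, p, fun x => ⟨hpos' x, ?_⟩, fun x y => ?_⟩
  · rw [lt_div_iff₀ (by positivity)] at hlt
    have := mul_le_mul_of_nonneg_left hm' (zero_le_one.trans hC)
    linarith [hM x, hbounded n]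
  · exact ((hM x).trans (hbounded n)).trans (mul_le_mul_of_nonneg_left (hm y) (by positivity))

lemma HasSmallReturns.deriv_iterate_le {C : ℝ} (h : HasSmallReturns F C)
    (hF : Differentiable ℝ F) (hFper : ∀ x, F (x + 1) = F x + 1) (k : ℕ) (x : ℝ) :
    deriv F^[k] x ≤ C ∧ 1 ≤ C * deriv F^[k] x := by
  choose q p hpos hle using fun n : ℕ => h (1 / ((n : ℝ) + 1)) (by positivity)
  set g : ℕ → ℝ → ℝ := fun n y => F^[q n] y - y - p n with hg
  have hpos' : ∀ n y, 0 < g n y := fun n y => (hpos n y).1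
  have hle' : ∀ n y z, g n y ≤ C * g n z := hle
  have hlim : Tendsto (fun n => x + g n x) atTop (𝓝[≠] x) := by
    refine tendsto_nhdsWithin_iff.2 ⟨?_, Eventually.of_forall fun n => ?_⟩
    · have : Tendsto (fun n => g n x) atTop (𝓝 0) :=
        squeeze_zero (fun n => (hpos' n x).le) (fun n => (hpos n x).2.le)
          tendsto_one_div_add_atTop_nhds_zero_nat
      simpa using this.const_add x
    · simpa using (hpos' n x).ne'
  have hslope := (((hF.iterate k) x).hasDerivAt.tendsto_slope).comp hlim
  have heq : ∀ n, slope F^[k] x (x + g n x) = g n (F^[k] x) / g n x := fun n => by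
    rw [slope_def_field, add_sub_cancel_left]
    congr 1
    have : x + g n x = F^[q n] x - p n := by simp only [hg]; ring
    rw [this, iterate_sub_natCast hFper, ← Function.iterate_add_apply, add_comm,
      Function.iterate_add_apply]
    simp only [hg]
    ring
  simp only [Function.comp_def, heq] at hslope
  constructor
  · exact le_of_tendsto' hslope fun n => (div_le_iff₀ (hpos' n x)).2 (hle' n _ _)
  · refine ge_of_tendsto' (hslope.const_mul C) fun n => ?_
    rw [← mul_div_assoc, one_le_div (hpos' n x)]
    exact hle' n _ _

lemma HasSmallReturns.eq_univ {C : ℝ} (h : HasSmallReturns F C) {E : Set ℝ}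
    (hE : IsClosed E) (hne : E.Nonempty)
    (hper : ∀ x (m : ℤ), x ∈ E → x + m ∈ E) (hinv : ∀ x ∈ E, F x ∈ E) : E = Set.univ := by
  refine Set.eq_univ_of_forall fun y => ?_
  rw [← hE.closure_eq, Metric.mem_closure_iff]
  intro ε hε
  obtain ⟨q, p, hpos, hle⟩ := h ε hε
  obtain ⟨x₀, hx₀⟩ := hne
  set x := x₀ + ((⌊y - x₀⌋ : ℤ) : ℝ) with hx
  have hxE : x ∈ E := hper _ _ hx₀
  have hxy : x ≤ y := by linarith [Int.floor_le (y - x₀)]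
  set G : ℝ → ℝ := fun z => F^[q] z - p with hG
  have hGE : ∀ j, G^[j] x ∈ E := by
    intro j
    induction j with
    | zero => exact hxE
    | succ j ih =>
      rw [Function.iterate_succ_apply']
      have h1 : F^[q] (G^[j] x) ∈ E :=
        (show Set.MapsTo F E E from fun z hz => hinv z hz).iterate q ih
      simpa [hG, sub_eq_add_neg] using hper _ (-(p : ℤ)) h1
  have hδ : 0 < G x - x := by simpa [hG, sub_right_comm] using (hpos x).1
  have hC : 0 < C := by
    have h1 := hle x x
    have h2 := (hpos x).1
    nlinarith
  have hgrow : ∀ j : ℕ, x + j * ((G x - x) / C) ≤ G^[j] x := by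
    intro j
    induction j with
    | zero => simp
    | succ j ih =>
      rw [Function.iterate_succ_apply']
      have h1 : (G x - x) / C ≤ G (G^[j] x) - G^[j] x := by
        rw [div_le_iff₀' hC]
        simpa [hG, sub_right_comm] using hle x (G^[j] x)
      push_cast
      linarith
  have hex : ∃ j : ℕ, y < G^[j] x := by
    obtain ⟨j, hj⟩ := exists_nat_gt ((y - x) / ((G x - x) / C))
    rw [div_lt_iff₀ (by positivity)] at hj
    exact ⟨j, by linarith [hgrow j]⟩
  classical
  obtain ⟨j, hj⟩ : ∃ j, Nat.find hex = j + 1 := by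
    refine Nat.exists_eq_succ_of_ne_zero fun h0 => ?_
    have := Nat.find_spec hex
    rw [h0] at this
    exact absurd this hxy.not_gt
  have h1 : y < G^[j + 1] x := hj ▸ Nat.find_spec hex
  have h2 : G^[j] x ≤ y := not_lt.1 (Nat.find_min hex (by omega))
  refine ⟨G^[j] x, hGE j, ?_⟩
  rw [Function.iterate_succ_apply'] at h1
  have h3 := (hpos (G^[j] x)).2
  rw [Real.dist_eq, abs_of_nonneg (by linarith)]
  simp only [hG] at h1 h3 ⊢
  linarith

/-- A multiplicative form of the Gottschalk–Hedlund theorem for the derivative cocycle. -/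
lemma HasSmallReturns.exists_density {C : ℝ} (h : HasSmallReturns F C)
    (hF : ContDiff ℝ 1 F) (hFderiv : ∀ x, 0 < deriv F x)
    (hFper : ∀ x, F (x + 1) = F x + 1) :
    ∃ B : ℝ → ℝ, Continuous B ∧ (∀ x, 0 < B x) ∧ (∀ x, B (x + 1) = B x) ∧
      ∀ x, B (F x) * deriv F x = B x := by
  have hFd : Differentiable ℝ F := hF.differentiable one_ne_zero
  set D : ℕ → ℝ → ℝ := fun n => deriv F^[n] with hD
  have hDcont : ∀ n, Continuous (D n) := fun n => by
    have : ContDiff ℝ 1 F^[n] := by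
      induction n with
      | zero => exact contDiff_id
      | succ n ih => exact ih.comp hF
    exact this.continuous_deriv le_rfl
  have hbd : ∀ n x, D n x ≤ C ∧ 1 ≤ C * D n x := fun n x => h.deriv_iterate_le hFd hFper n x
  have hD0 : ∀ x, D 0 x = 1 := fun x => by simp [hD]
  have hC : 0 < C := by linarith [(hbd 0 0).1, hD0 0]
  have hDlow : ∀ n x, C⁻¹ ≤ D n x := fun n x => (inv_le_iff_one_le_mul₀' hC).2 (hbd n x).2
  have hDpos : ∀ n x, 0 < D n x := fun n x => (inv_pos.2 hC).trans_le (hDlow n x)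
  have hDF : ∀ n x, D n (F x) * deriv F x = D (n + 1) x := fun n x => by
    simp only [hD, Function.iterate_succ]
    exact (deriv_comp x ((hFd.iterate n) _) (hFd x)).symm
  have hDper : ∀ n, Function.Periodic (D n) 1 := fun n x => by
    have h1 : (fun y => F^[n] (y + 1)) = fun y => F^[n] y + 1 := funext fun y => by
      simpa using iterate_add_natCast hFper n 1 y
    simp only [hD]
    rw [← deriv_comp_add_const, h1, deriv_add_const]
  have hA : ∀ x, BddAbove (Set.range fun n => D n x) := fun x =>
    ⟨C, by rintro _ ⟨n, rfl⟩; exact (hbd n x).1⟩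
  have hBl : ∀ x, BddBelow (Set.range fun n => D n x) := fun x =>
    ⟨0, by rintro _ ⟨n, rfl⟩; exact (hDpos n x).le⟩
  set B : ℝ → ℝ := fun x => ⨆ n, D n x with hBdef
  set A : ℝ → ℝ := fun x => ⨅ n, D n x with hAdef
  have hDB : ∀ n x, D n x ≤ B x := fun n x => le_ciSup (hA x) n
  have hAD : ∀ n x, A x ≤ D n x := fun n x => ciInf_le (hBl x) n
  have hApos : ∀ x, 0 < A x := fun x => (inv_pos.2 hC).trans_le (le_ciInf fun n => hDlow n x)
  have hBpos : ∀ x, 0 < B x := fun x => (hDpos 0 x).trans_le (hDB 0 x)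
  have hall : ∀ x y, B x ≤ B y / A y * A x := by
    intro x y
    set c := B y / A y with hc
    have hc0 : 0 < c := div_pos (hBpos y) (hApos y)
    set E : Set ℝ := {z | ∀ n m, D n z ≤ c * D m z} with hE
    have huniv : E = Set.univ := by
      refine h.eq_univ ?_ ⟨y, fun n m => ?_⟩ ?_ ?_
      · simp only [hE, Set.ofPred_forall]
        exact isClosed_iInter fun n => isClosed_iInter fun m =>
          isClosed_le (hDcont n) (continuous_const.mul (hDcont m))
      · calc D n y ≤ B y := hDB n y
          _ = c * A y := (div_mul_cancel₀ _ (hApos y).ne').symm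
          _ ≤ c * D m y := mul_le_mul_of_nonneg_left (hAD m y) hc0.le
      · intro z k hz n m
        have hk : ∀ n, D n (z + k) = D n z := fun n => by
          simpa using (hDper n).int_mul k z
        rw [hk, hk]
        exact hz n m
      · intro z hz n m
        have h1 := hz (n + 1) (m + 1)
        rw [← hDF, ← hDF, ← mul_assoc] at h1
        exact le_of_mul_le_mul_right h1 (hFderiv z)
    have hx : x ∈ E := huniv ▸ Set.mem_univ x
    refine ciSup_le fun n => ?_
    rw [← div_le_iff₀' hc0]
    exact le_ciInf fun m => (div_le_iff₀' hc0).2 (hx n m)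
  set κ := B 0 / A 0 with hκ
  have hκ0 : 0 < κ := div_pos (hBpos 0) (hApos 0)
  have hBA : ∀ x, B x = κ * A x := fun x => by
    refine le_antisymm (hall x 0) ?_
    have h1 := hall 0 x
    rw [div_mul_eq_mul_div, le_div_iff₀ (hApos x)] at h1
    rw [hκ, div_mul_eq_mul_div, div_le_iff₀ (hApos 0)]
    exact h1
  refine ⟨B, ?_, hBpos, fun x => iSup_congr fun n => hDper n x, fun x => le_antisymm ?_ ?_⟩
  · rw [continuous_iff_lower_upperSemicontinuous]
    constructor
    · exact lowerSemicontinuous_ciSup hA fun n => (hDcont n).lowerSemicontinuous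
    · have h1 : B = fun x => ⨅ n, κ * D n x := funext fun x => by
        rw [hBA, Real.mul_iInf_of_nonneg hκ0.le]
      rw [h1]
      refine upperSemicontinuous_ciInf (fun x => ⟨0, ?_⟩) fun n =>
        (continuous_const.mul (hDcont n)).upperSemicontinuous
      rintro _ ⟨n, rfl⟩
      exact (mul_pos hκ0 (hDpos n x)).le
  · rw [← le_div_iff₀ (hFderiv x)]
    exact ciSup_le fun n => (le_div_iff₀ (hFderiv x)).2 ((hDF n x).trans_le (hDB _ x))
  · rw [hBA, hBA, mul_assoc]
    refine mul_le_mul_of_nonneg_left ?_ hκ0.le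
    rw [← div_le_iff₀ (hFderiv x)]
    exact le_ciInf fun n => (div_le_iff₀ (hFderiv x)).2 ((hAD _ x).trans_eq (hDF n x).symm)

/-- A continuous positive invariant density integrates to a `C¹` conjugacy with the rotation. -/
lemma exists_conjugacy_of_density {α : ℝ} (hF : Differentiable ℝ F) (hρ : IsRotNumber F α)
    {B : ℝ → ℝ} (hB : Continuous B) (hBpos : ∀ x, 0 < B x) (hBper : ∀ x, B (x + 1) = B x)
    (hBinv : ∀ x, B (F x) * deriv F x = B x) :
    ∃ H : ℝ → ℝ, ContDiff ℝ 1 H ∧ (∀ x, 0 < deriv H x) ∧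
      (∀ x, H (x + 1) = H x + 1) ∧ ∀ x, H (F x) = H x + α := by
  set I := ∫ t in (0 : ℝ)..1, B t with hI
  have hIpos : 0 < I := intervalIntegral.intervalIntegral_pos_of_pos
    (hB.intervalIntegrable _ _) hBpos one_pos
  set H : ℝ → ℝ := fun x => (∫ t in (0 : ℝ)..x, B t) / I with hH
  have hderiv : ∀ x, HasDerivAt H (B x / I) x := fun x =>
    (intervalIntegral.integral_hasDerivAt_right (hB.intervalIntegrable _ _)
      (hB.stronglyMeasurableAtFilter _ _) hB.continuousAt).div_const I
  have hderiv' : deriv H = fun x => B x / I := funext fun x => (hderiv x).deriv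
  have hHd : Differentiable ℝ H := fun x => (hderiv x).differentiableAt
  have hHper : ∀ x, H (x + 1) = H x + 1 := fun x => by
    have h1 := Function.Periodic.intervalIntegral_add_eq (f := B) (T := 1) hBper 0 x
    have h2 := intervalIntegral.integral_add_adjacent_intervals
      (hB.intervalIntegrable 0 x) (hB.intervalIntegrable (μ := MeasureTheory.volume) x (x + 1))
    rw [← h1, zero_add] at h2
    simp only [hH]
    rw [← h2, add_div, div_self hIpos.ne']
  obtain ⟨τ, hτ⟩ : ∃ τ, ∀ x, H (F x) = H x + τ := by
    refine ⟨H (F 0) - H 0, fun x => ?_⟩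
    have hd : ∀ y, HasDerivAt (fun y => H (F y) - H y) 0 y := fun y => by
      have h1 := ((hderiv (F y)).comp y (hF y).hasDerivAt).sub (hderiv y)
      rwa [div_mul_eq_mul_div, hBinv, sub_self] at h1
    have := is_const_of_deriv_eq_zero (fun y => (hd y).differentiableAt)
      (fun y => (hd y).deriv) x 0
    linarith
  have hiter : ∀ n : ℕ, H (F^[n] 0) = H 0 + n * τ := fun n => by
    induction n with
    | zero => simp
    | succ n ih =>
      rw [Function.iterate_succ_apply', hτ, ih]
      push_cast
      ring
  obtain ⟨K, hK⟩ : ∃ K, ∀ x, |H x - x| ≤ K := by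
    have hper : Function.Periodic (fun x => H x - x) 1 := fun x => by
      simp only [hHper]
      ring
    obtain ⟨K, hK⟩ := (hper.isBounded_of_continuous one_ne_zero
      (hHd.continuous.sub continuous_id)).exists_norm_le
    exact ⟨K, fun x => hK _ ⟨x, rfl⟩⟩
  have hα : τ = α := by
    refine le_antisymm ?_ ?_
    · rw [← one_mul α, ← Nat.cast_one]
      refine hρ.le_mul (x := 0) (K := H 0 - K) one_pos fun k => ?_
      have := (abs_le.1 (hK (F^[k] 0))).2
      rw [mul_one]
      linarith [hiter k]
    · rw [← one_mul α, ← Nat.cast_one]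
      refine hρ.mul_le (x := 0) (K := H 0 + K) one_pos fun k => ?_
      have := (abs_le.1 (hK (F^[k] 0))).1
      rw [mul_one]
      linarith [hiter k]
  refine ⟨H, ?_, fun x => ?_, hHper, fun x => hα ▸ hτ x⟩
  · rw [contDiff_one_iff_deriv, hderiv']
    exact ⟨hHd, hB.div_const I⟩
  · rw [hderiv']
    exact div_pos (hBpos x) hIpos

end Lift

/-- **Criterion for `C¹`-linearization.** Let `f` be an orientation-preserving `C¹` circle
diffeomorphism with irrational rotation number `α ∈ (0,1)`, with convergents `p_n/q_n`,
and let `β_n(x) = |f^{q_n}(x) - x|`, `m_n = min β_n`, `M_n = max β_n`. If the sequence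
`M_n / m_n` is bounded, then `f` is `C¹`-conjugated to the rotation `T_α`. -/
theorem c1_linearization_criterion (α : ℝ) (hirr : Irrational α)
    (hα : α ∈ Set.Ioo (0 : ℝ) 1)
    (F : ℝ → ℝ) (hF : ContDiff ℝ 1 F) (hFderiv : ∀ x, 0 < deriv F x)
    (hFper : ∀ x, F (x + 1) = F x + 1) (hρ : IsRotNumber F α)
    (hbounded : ∃ C : ℝ, ∀ n : ℕ, Mseq α F n ≤ C * mseq α F n) :
    ∃ H : ℝ → ℝ, ContDiff ℝ 1 H ∧ (∀ x, 0 < deriv H x) ∧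
      (∀ x, H (x + 1) = H x + 1) ∧ ∀ x, H (F x) = H x + α := by
  obtain ⟨C, hC⟩ := hbounded
  have hFd : Differentiable ℝ F := hF.differentiable one_ne_zero
  have hm : ∀ n, 0 ≤ mseq α F n := fun n =>
    Real.sInf_nonneg (by rintro _ ⟨x, rfl⟩; exact abs_nonneg _)
  have hret : HasSmallReturns F (max C 1) :=
    hasSmallReturns_of_bounded hirr hα hF.continuous
      (strictMono_of_deriv_pos hFderiv).monotone hFper hρ (le_max_right _ _) fun n =>
      (hC n).trans (mul_le_mul_of_nonneg_right (le_max_left _ _) (hm n))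
  obtain ⟨B, hB, hBpos, hBper, hBinv⟩ := hret.exists_density hF hFderiv hFper
  exact exists_conjugacy_of_density hFd hρ hB hBpos hBper hBinv
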